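/- arXiv:2111.07754 — 8 statements merged into one kernel-verified Lean document; each statement's English description precedes it below -/
import Mathlib

section
/- Let l ≥ 2 be an integer, and set m = 2^l, r = 2^{l−1}, C = A_{l−1} ∪ (2^{l−1} + 1 + B_{l−1}), and D = B_{l−1} ∪ (2^{l−1} + 1 + A_{l−1}). Then C ∪ D = [0, m] \ {r}, C ∩ D = ∅, 0 ∈ C, and R_C(n) = R_D(n) for every nonnegative integer n. -/
/-- `R S n` is the number of pairs `(s₁, s₂)` with `s₁, s₂ ∈ S`, `s₁ < s₂` and `s₁ + s₂ = n`. -/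
noncomputable def R (S : Set ℕ) (n : ℕ) : ℕ :=
  Set.ncard {p : ℕ × ℕ | p.1 ∈ S ∧ p.2 ∈ S ∧ p.1 < p.2 ∧ p.1 + p.2 = n}

/-- `A` is the set of nonnegative integers with an even number of binary digits `1`. -/
def A : Set ℕ := {n | Even ((Nat.digits 2 n).count 1)}

/-- `B = ℕ \ A`. -/
def B : Set ℕ := Set.univ \ A

/-- `A_l = A ∩ [0, 2^l - 1]`. -/
def Aset (l : ℕ) : Set ℕ := A ∩ Set.Icc 0 (2 ^ l - 1)

/-- `B_l = B ∩ [0, 2^l - 1]`. -/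
def Bset (l : ℕ) : Set ℕ := B ∩ Set.Icc 0 (2 ^ l - 1)

/-- `t + S = {t + s : s ∈ S}`. -/
def shift (t : ℕ) (S : Set ℕ) : Set ℕ := (fun s => t + s) '' S

open Polynomial

theorem two_mul_mem_A (n : ℕ) : 2 * n ∈ A ↔ n ∈ A := by
  rcases Nat.eq_zero_or_pos n with rfl | h
  · simp
  · have := Nat.digits_add_two_add_one 0 (2 * n - 1)
    rw [show 2 * n - 1 + 1 = 2 * n by omega] at this
    simp [A, this]

theorem two_mul_add_one_mem_A (n : ℕ) : 2 * n + 1 ∈ A ↔ n ∉ A := by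
  have := Nat.digits_add_two_add_one 0 (2 * n)
  have h1 : (2 * n + 1) % 2 = 1 := by omega
  have h2 : (2 * n + 1) / 2 = n := by omega
  simp only [zero_add, h1, h2] at this
  simp only [A, Set.mem_ofPred_eq, this, List.count_cons_self, Nat.even_add_one]

theorem sum_range_two_mul {M : Type*} [AddCommMonoid M] (f : ℕ → M) (n : ℕ) :
    ∑ i ∈ Finset.range (2 * n), f i = ∑ i ∈ Finset.range n, (f (2 * i) + f (2 * i + 1)) := by
  induction n with
  | zero => simp
  | succ n ih =>
    rw [Finset.sum_range_succ, ← ih, show 2 * (n + 1) = 2 * n + 1 + 1 by ring,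
      Finset.sum_range_succ, Finset.sum_range_succ, add_assoc]

/-- The generating polynomial `∑ i ∈ F, X ^ i` of a finite set of naturals. -/
noncomputable def genPoly (F : Finset ℕ) : ℤ[X] := ∑ i ∈ F, X ^ i

theorem genPoly_union_map {F G : Finset ℕ} {t : ℕ} (h : ∀ i ∈ F, i < t) :
    genPoly (F ∪ G.map (addLeftEmbedding t)) = genPoly F + X ^ t * genPoly G := by
  rw [genPoly, Finset.sum_union]
  · simp [genPoly, Finset.mul_sum, pow_add]
  · rw [Finset.disjoint_left]
    intro i hi hi'
    obtain ⟨j, -, rfl⟩ := Finset.mem_map.1 hi'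
    have := h _ hi
    simp at this

/-- The coefficients of `F(X)² - F(X²)` count each pair of distinct elements twice. -/
theorem two_mul_R_add_coeff (F : Finset ℕ) (n : ℕ) :
    2 * (R F n : ℤ) + (expand ℤ 2 (genPoly F)).coeff n = (genPoly F ^ 2).coeff n := by
  have hR : R F n = ((F ×ˢ F).filter fun p => p.1 < p.2 ∧ p.1 + p.2 = n).card := by
    rw [R, ← Set.ncard_coe_finset]
    congr 1
    ext p
    simp [and_assoc]
  have hswap : ((F ×ˢ F).filter fun p => p.2 < p.1 ∧ p.1 + p.2 = n).card =
      ((F ×ˢ F).filter fun p => p.1 < p.2 ∧ p.1 + p.2 = n).card := by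
    refine Finset.card_bij' (fun p _ => p.swap) (fun p _ => p.swap) ?_ ?_ ?_ ?_ <;>
      simp +contextual [add_comm]
  have hsq : (genPoly F ^ 2).coeff n = ∑ p ∈ F ×ˢ F, if p.1 + p.2 = n then (1 : ℤ) else 0 := by
    simp only [genPoly, sq, Finset.sum_mul_sum, ← Finset.sum_product', finsetSum_coeff,
      ← pow_add, coeff_X_pow, eq_comm]
  have hdiag : (expand ℤ 2 (genPoly F)).coeff n =
      ∑ p ∈ F ×ˢ F, if p.1 = p.2 ∧ p.1 + p.2 = n then (1 : ℤ) else 0 := by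
    simp only [genPoly, map_sum, map_pow, expand_X, ← pow_mul, finsetSum_coeff, coeff_X_pow,
      Finset.sum_product]
    refine Finset.sum_congr rfl fun i hi => ?_
    simp only [ite_and, Finset.sum_ite_eq, hi, if_true]
    simp only [two_mul, eq_comm]
  have hcard : 2 * (R F n : ℤ) =
      (∑ p ∈ F ×ˢ F, if p.1 < p.2 ∧ p.1 + p.2 = n then (1 : ℤ) else 0) +
        ∑ p ∈ F ×ˢ F, if p.2 < p.1 ∧ p.1 + p.2 = n then (1 : ℤ) else 0 := by
    rw [Finset.sum_boole, Finset.sum_boole, hswap, hR, two_mul]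
  rw [hcard, hdiag, hsq, ← Finset.sum_add_distrib, ← Finset.sum_add_distrib]
  refine Finset.sum_congr rfl fun p _ => ?_
  rcases lt_trichotomy p.1 p.2 with h | h | h
  · simp [h, h.ne, h.le]
  · simp [h]
  · simp [h, h.ne', h.le]

theorem R_eq_of_genPoly {F G : Finset ℕ}
    (h : genPoly F ^ 2 - genPoly G ^ 2 = expand ℤ 2 (genPoly F) - expand ℤ 2 (genPoly G)) (n : ℕ) :
    R F n = R G n := by
  have hF := two_mul_R_add_coeff F n
  have hG := two_mul_R_add_coeff G n
  have h' := congrArg (fun p => coeff p n) h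
  simp only [coeff_sub] at h'
  lia

open Classical in
/-- `Aset k` as a finset. -/
noncomputable def evilFinset (k : ℕ) : Finset ℕ := (Finset.range (2 ^ k)).filter (· ∈ A)

open Classical in
/-- `Bset k` as a finset. -/
noncomputable def odiousFinset (k : ℕ) : Finset ℕ := (Finset.range (2 ^ k)).filter (· ∉ A)

theorem coe_evilFinset (k : ℕ) : (evilFinset k : Set ℕ) = Aset k := by
  ext i
  have := Nat.two_pow_pos k
  simp [evilFinset, Aset, and_comm, Nat.le_sub_one_iff_lt this]

theorem coe_odiousFinset (k : ℕ) : (odiousFinset k : Set ℕ) = Bset k := by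
  ext i
  have := Nat.two_pow_pos k
  simp [odiousFinset, Bset, B, and_comm, Nat.le_sub_one_iff_lt this]

theorem genPoly_evilFinset_succ (k : ℕ) : genPoly (evilFinset (k + 1)) =
    expand ℤ 2 (genPoly (evilFinset k)) + X * expand ℤ 2 (genPoly (odiousFinset k)) := by
  simp only [genPoly, evilFinset, odiousFinset, Finset.sum_filter, pow_succ', sum_range_two_mul,
    map_sum, Finset.mul_sum, ← Finset.sum_add_distrib]
  refine Finset.sum_congr rfl fun i _ => ?_
  by_cases h : i ∈ A <;> simp [h, two_mul_mem_A, two_mul_add_one_mem_A] <;> ring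

theorem genPoly_odiousFinset_succ (k : ℕ) : genPoly (odiousFinset (k + 1)) =
    expand ℤ 2 (genPoly (odiousFinset k)) + X * expand ℤ 2 (genPoly (evilFinset k)) := by
  simp only [genPoly, evilFinset, odiousFinset, Finset.sum_filter, pow_succ', sum_range_two_mul,
    map_sum, Finset.mul_sum, ← Finset.sum_add_distrib]
  refine Finset.sum_congr rfl fun i _ => ?_
  by_cases h : i ∈ A <;> simp [h, two_mul_mem_A, two_mul_add_one_mem_A] <;> ring

theorem zero_mem_A : 0 ∈ A := by simp [A]

theorem genPoly_evil_sq_sub_odious_sq (k : ℕ) :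
    genPoly (evilFinset k) ^ 2 - genPoly (odiousFinset k) ^ 2 =
      expand ℤ 2 (genPoly (evilFinset k)) - expand ℤ 2 (genPoly (odiousFinset k)) := by
  induction k with
  | zero => simp [genPoly, evilFinset, odiousFinset, Finset.sum_filter, zero_mem_A]
  | succ k ih =>
    have h := congrArg (expand ℤ 2) ih
    simp only [map_sub, map_pow] at h
    simp only [genPoly_evilFinset_succ, genPoly_odiousFinset_succ, map_add, map_mul, expand_X]
    linear_combination (1 - X ^ 2) * h

theorem R_union_shift_eq {k t : ℕ} (ht : 2 ^ k ≤ t) (n : ℕ) :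
    R (Aset k ∪ shift t (Bset k)) n = R (Bset k ∪ shift t (Aset k)) n := by
  have hA : ∀ i ∈ evilFinset k, i < t := fun i hi => by
    simp only [evilFinset, Finset.mem_filter, Finset.mem_range] at hi
    exact hi.1.trans_le ht
  have hB : ∀ i ∈ odiousFinset k, i < t := fun i hi => by
    simp only [odiousFinset, Finset.mem_filter, Finset.mem_range] at hi
    exact hi.1.trans_le ht
  have key := R_eq_of_genPoly (F := evilFinset k ∪ (odiousFinset k).map (addLeftEmbedding t))
    (G := odiousFinset k ∪ (evilFinset k).map (addLeftEmbedding t)) (by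
      rw [genPoly_union_map hA, genPoly_union_map hB]
      simp only [map_add, map_mul, map_pow, expand_X]
      linear_combination (1 - X ^ (2 * t)) * genPoly_evil_sq_sub_odious_sq k) n
  simpa only [Finset.coe_union, Finset.coe_map, coe_evilFinset, coe_odiousFinset,
    addLeftEmbedding_apply, shift] using key

theorem mem_shift {t n : ℕ} {S : Set ℕ} : n ∈ shift t S ↔ t ≤ n ∧ n - t ∈ S := by
  constructor
  · rintro ⟨s, hs, rfl⟩
    simpa using hs
  · rintro ⟨h, hs⟩
    exact ⟨n - t, hs, by simp [h]⟩

theorem stmt_1 (l : ℕ) (hl : 2 ≤ l) (m r : ℕ) (C D : Set ℕ)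
    (hm : m = 2 ^ l) (hr : r = 2 ^ (l - 1))
    (hC : C = Aset (l - 1) ∪ shift (2 ^ (l - 1) + 1) (Bset (l - 1)))
    (hD : D = Bset (l - 1) ∪ shift (2 ^ (l - 1) + 1) (Aset (l - 1))) :
    C ∪ D = Set.Icc 0 m \ {r} ∧ C ∩ D = ∅ ∧ 0 ∈ C ∧ ∀ n : ℕ, R C n = R D n := by
  obtain ⟨k, rfl⟩ : ∃ k, l = k + 1 := ⟨l - 1, by omega⟩
  simp only [Nat.add_sub_cancel] at hr hC hD
  have hpos := Nat.two_pow_pos k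
  rw [pow_succ] at hm
  subst hC hD
  refine ⟨?_, ?_, Or.inl ⟨zero_mem_A, by simp⟩, R_union_shift_eq (Nat.le_succ _)⟩
  · ext n
    simp only [Set.mem_union, mem_shift, Aset, Bset, B, Set.mem_inter_iff, Set.mem_sdiff,
      Set.mem_univ, true_and, Set.mem_Icc, Set.mem_singleton_iff]
    by_cases h1 : n ∈ A <;> by_cases h2 : n - (2 ^ k + 1) ∈ A <;> simp only [h1, h2] <;> lia
  · ext n
    simp only [Set.mem_union, mem_shift, Aset, Bset, B, Set.mem_inter_iff, Set.mem_sdiff,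
      Set.mem_univ, true_and, Set.mem_Icc, Set.mem_empty_iff_false]
    by_cases h1 : n ∈ A <;> by_cases h2 : n - (2 ^ k + 1) ∈ A <;> simp only [h1, h2] <;> lia
end

section
/- Let 0 < r₁ < r₂ < ⋯ < r_s ≤ m be integers. If (C₁, D₁) and (C₂, D₂) are two pairs of sets of nonnegative integers such that, for each i ∈ {1, 2}: C_i ∪ D_i = [0, m] \ {r₁, r₂, …, r_s}, C_i ∩ D_i = ∅, 0 ∈ C_i, and R_{C_i}(k) = R_{D_i}(k) for all k ≤ m, then C₁ = C₂ and D₁ = D₂. -/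
theorem R_congr_of_zero_notMem {S T : Set ℕ} {k : ℕ} (hS : 0 ∉ S) (hT : 0 ∉ T)
    (h : ∀ j < k, (j ∈ S ↔ j ∈ T)) : R S k = R T k := by
  unfold R
  congr 1
  ext ⟨a, b⟩
  simp only [Set.mem_ofPred_eq]
  constructor
  · rintro ⟨ha, hb, hab, rfl⟩
    have : a ≠ 0 := fun h0 => hS (h0 ▸ ha)
    exact ⟨(h a (by omega)).1 ha, (h b (by omega)).1 hb, hab, rfl⟩
  · rintro ⟨ha, hb, hab, rfl⟩
    have : a ≠ 0 := fun h0 => hT (h0 ▸ ha)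
    exact ⟨(h a (by omega)).2 ha, (h b (by omega)).2 hb, hab, rfl⟩

theorem R_eq_succ_of_mem_of_notMem {S T : Set ℕ} {k : ℕ} (hk : 0 < k) (h0 : 0 ∈ S)
    (hkS : k ∈ S) (hkT : k ∉ T) (h : ∀ j < k, (j ∈ S ↔ j ∈ T)) : R S k = R T k + 1 := by
  unfold R
  have hfin : {p : ℕ × ℕ | p.1 ∈ T ∧ p.2 ∈ T ∧ p.1 < p.2 ∧ p.1 + p.2 = k}.Finite := by
    refine ((Set.finite_Iic k).prod (Set.finite_Iic k)).subset ?_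
    rintro ⟨a, b⟩ ⟨-, -, -, hab⟩
    simp only [Set.mem_prod, Set.mem_Iic] at *
    omega
  rw [← Set.ncard_insert_of_notMem (a := (0, k)) (fun hmem => hkT hmem.2.1) hfin]
  congr 1
  ext ⟨a, b⟩
  simp only [Set.mem_insert_iff, Set.mem_ofPred_eq, Prod.mk.injEq]
  constructor
  · rintro ⟨ha, hb, hab, hsum⟩
    rcases Nat.eq_zero_or_pos a with rfl | hpos
    · exact Or.inl ⟨rfl, by omega⟩
    · exact Or.inr ⟨(h a (by omega)).1 ha, (h b (by omega)).1 hb, hab, hsum⟩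
  · rintro (⟨rfl, rfl⟩ | ⟨ha, hb, hab, hsum⟩)
    · exact ⟨h0, hkS, hk, by omega⟩
    · have hbk : b ≠ k := fun hb' => hkT (hb' ▸ hb)
      exact ⟨(h a (by omega)).2 ha, (h b (by omega)).2 hb, hab, hsum⟩

theorem mem_of_agree_below {C₁ D₁ C₂ D₂ : Set ℕ} {k : ℕ} (hC₁ : 0 ∈ C₁) (hC₂ : 0 ∈ C₂)
    (hD₁ : 0 ∉ D₁) (hD₂ : 0 ∉ D₂) (hC : ∀ j < k, (j ∈ C₁ ↔ j ∈ C₂))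
    (hD : ∀ j < k, (j ∈ D₁ ↔ j ∈ D₂)) (h₁ : R C₁ k = R D₁ k) (h₂ : R C₂ k = R D₂ k)
    (hk : k ∈ C₁) : k ∈ C₂ := by
  by_contra hk₂
  have hpos : 0 < k := Nat.pos_of_ne_zero fun h => hk₂ (h ▸ hC₂)
  have hRC := R_eq_succ_of_mem_of_notMem hpos hC₁ hk hk₂ hC
  have hRD := R_congr_of_zero_notMem hD₁ hD₂ hD
  omega

theorem stmt_3 (m s : ℕ) (r : Fin s → ℕ) (hmono : StrictMono r)
    (hpos : ∀ i, 0 < r i) (hle : ∀ i, r i ≤ m)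
    (C₁ D₁ C₂ D₂ : Set ℕ)
    (hCD₁ : C₁ ∪ D₁ = Set.Icc 0 m \ Set.range r) (hdisj₁ : C₁ ∩ D₁ = ∅)
    (h0₁ : 0 ∈ C₁) (hR₁ : ∀ k ≤ m, R C₁ k = R D₁ k)
    (hCD₂ : C₂ ∪ D₂ = Set.Icc 0 m \ Set.range r) (hdisj₂ : C₂ ∩ D₂ = ∅)
    (h0₂ : 0 ∈ C₂) (hR₂ : ∀ k ≤ m, R C₂ k = R D₂ k) :
    C₁ = C₂ ∧ D₁ = D₂ := by
  have hD₁ : D₁ = (Set.Icc 0 m \ Set.range r) \ C₁ := by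
    rw [← hCD₁, Set.union_sdiff_cancel_left hdisj₁.le]
  have hD₂ : D₂ = (Set.Icc 0 m \ Set.range r) \ C₂ := by
    rw [← hCD₂, Set.union_sdiff_cancel_left hdisj₂.le]
  have hm₁ : ∀ k ∈ C₁, k ≤ m := fun k hk => (hCD₁.subset (Or.inl hk)).1.2
  have hm₂ : ∀ k ∈ C₂, k ≤ m := fun k hk => (hCD₂.subset (Or.inl hk)).1.2
  have hz₁ : 0 ∉ D₁ := fun h => hdisj₁.subset ⟨h0₁, h⟩
  have hz₂ : 0 ∉ D₂ := fun h => hdisj₂.subset ⟨h0₂, h⟩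
  have hC : ∀ k, k ∈ C₁ ↔ k ∈ C₂ := by
    intro k
    induction k using Nat.strong_induction_on with
    | _ k ih =>
      have ihD : ∀ j < k, (j ∈ D₁ ↔ j ∈ D₂) := fun j hj => by
        simp only [hD₁, hD₂, Set.mem_sdiff, ih j hj]
      constructor
      · intro hk
        exact mem_of_agree_below h0₁ h0₂ hz₁ hz₂ ih ihD (hR₁ k (hm₁ k hk)) (hR₂ k (hm₁ k hk)) hk
      · intro hk
        exact mem_of_agree_below h0₂ h0₁ hz₂ hz₁ (fun j hj => (ih j hj).symm)
          (fun j hj => (ihD j hj).symm) (hR₂ k (hm₂ k hk)) (hR₁ k (hm₂ k hk)) hk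
  have hCeq : C₁ = C₂ := Set.ext hC
  exact ⟨hCeq, by rw [hD₁, hD₂, hCeq]⟩
end

section
/- Suppose C and D are sets of nonnegative integers satisfying C ∪ D = [0, m] \ {r₁, …, r_s}, C ∩ D = ∅, and R_C(n) = R_D(n) for every positive integer n. Let C′ = m − C = {m − c : c ∈ C} and D′ = m − D = {m − d : d ∈ D}. Then C′ ∪ D′ = [0, m] \ {m − r₁, …, m − r_s}, C′ ∩ D′ = ∅, and R_{C′}(n) = R_{D′}(n) for all nonnegative integers n. -/
theorem R_zero (S : Set ℕ) : R S 0 = 0 := by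
  have h : {p : ℕ × ℕ | p.1 ∈ S ∧ p.2 ∈ S ∧ p.1 < p.2 ∧ p.1 + p.2 = 0} = ∅ := by
    ext p
    simp only [Set.mem_ofPred_eq, Set.mem_empty_iff_false, iff_false]
    omega
  rw [R, h, Set.ncard_empty]

theorem R_eq_zero_of_two_mul_lt {m n : ℕ} {S : Set ℕ} (hS : ∀ x ∈ S, x ≤ m) (hn : 2 * m < n) :
    R S n = 0 := by
  have h : {p : ℕ × ℕ | p.1 ∈ S ∧ p.2 ∈ S ∧ p.1 < p.2 ∧ p.1 + p.2 = n} = ∅ := by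
    ext p
    simp only [Set.mem_ofPred_eq, Set.mem_empty_iff_false, iff_false]
    rintro ⟨h₁, h₂, -, h⟩
    have := hS _ h₁
    have := hS _ h₂
    omega
  rw [R, h, Set.ncard_empty]

/-- Reflecting `S ⊆ [0, m]` about `m / 2` reflects its representation function about `m`. -/
theorem R_image_sub {m n : ℕ} {S : Set ℕ} (hS : ∀ x ∈ S, x ≤ m) (hn : n ≤ 2 * m) :
    R ((fun x => m - x) '' S) n = R S (2 * m - n) := by
  symm
  refine Set.ncard_congr (fun p _ => (m - p.2, m - p.1)) ?_ ?_ ?_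
  · rintro ⟨a, b⟩ ⟨ha, hb, hab, h⟩
    have := hS _ ha
    have := hS _ hb
    refine ⟨⟨b, hb, rfl⟩, ⟨a, ha, rfl⟩, ?_, ?_⟩ <;> dsimp only at * <;> omega
  · rintro ⟨a, b⟩ ⟨c, d⟩ ⟨ha, hb, -, -⟩ ⟨hc, hd, -, -⟩ h
    have := hS _ ha
    have := hS _ hb
    have := hS _ hc
    have := hS _ hd
    simp only [Prod.mk.injEq] at *
    omega
  · rintro ⟨-, -⟩ ⟨⟨a, ha, rfl⟩, ⟨b, hb, rfl⟩, hab, h⟩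
    have := hS _ ha
    have := hS _ hb
    refine ⟨(b, a), ⟨hb, ha, ?_, ?_⟩, rfl⟩ <;> dsimp only at * <;> omega

/-- Truncated subtraction from `m` is injective on `[0, m]`. -/
theorem injOn_sub_Icc (m : ℕ) : Set.InjOn (fun x => m - x) (Set.Icc 0 m) := by
  intro a ha b hb h
  simp only [Set.mem_Icc] at *
  omega

theorem image_sub_Icc (m : ℕ) : (fun x => m - x) '' Set.Icc 0 m = Set.Icc 0 m := by
  ext x
  simp only [Set.mem_image, Set.mem_Icc]
  exact ⟨fun ⟨y, _, h⟩ => by omega, fun h => ⟨m - x, by omega, by omega⟩⟩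

theorem stmt_4 (m s : ℕ) (r : Fin s → ℕ) (hmono : StrictMono r)
    (hpos : ∀ i, 0 < r i) (hle : ∀ i, r i ≤ m)
    (C D : Set ℕ)
    (hCD : C ∪ D = Set.Icc 0 m \ Set.range r) (hdisj : C ∩ D = ∅)
    (hR : ∀ n : ℕ, 0 < n → R C n = R D n)
    (C' D' : Set ℕ) (hC' : C' = (fun c => m - c) '' C) (hD' : D' = (fun d => m - d) '' D) :
    C' ∪ D' = Set.Icc 0 m \ Set.range (fun i => m - r i) ∧ C' ∩ D' = ∅ ∧
      ∀ n : ℕ, R C' n = R D' n := by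
  have hsub : C ∪ D ⊆ Set.Icc 0 m := hCD ▸ Set.sdiff_subset
  have hC : C ⊆ Set.Icc 0 m := Set.subset_union_left.trans hsub
  have hD : D ⊆ Set.Icc 0 m := Set.subset_union_right.trans hsub
  have hr : Set.range r ⊆ Set.Icc 0 m := by
    rintro _ ⟨i, rfl⟩
    exact ⟨Nat.zero_le _, hle i⟩
  subst hC' hD'
  refine ⟨?_, ?_, fun n => ?_⟩
  · rw [← Set.image_union, hCD, (injOn_sub_Icc m).image_sdiff_subset hr, image_sub_Icc,
      ← Set.range_comp]
    rfl
  · rw [← (injOn_sub_Icc m).image_inter hC hD, hdisj, Set.image_empty]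
  · rcases le_or_gt n (2 * m) with hn | hn
    · rw [R_image_sub (fun x hx => (hC hx).2) hn, R_image_sub (fun x hx => (hD hx).2) hn]
      rcases Nat.eq_zero_or_pos (2 * m - n) with h | h
      · rw [h, R_zero, R_zero]
      · exact hR _ h
    · have hle' (S : Set ℕ) : ∀ x ∈ (fun x => m - x) '' S, x ≤ m := by
        rintro _ ⟨x, -, rfl⟩
        exact Nat.sub_le m x
      rw [R_eq_zero_of_two_mul_lt (hle' C) hn, R_eq_zero_of_two_mul_lt (hle' D) hn]
end

section
/- Let m be a positive integer not of the form 2^l − 1, and let C = A ∩ [0, m] and D = B ∩ [0, m]. Then there exists a positive integer n with m < n < 2m such that R_C(n) ≠ R_D(n). -/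
open Classical in
/-- The `±1`-valued Thue–Morse sequence. -/
noncomputable def thueMorseSign (n : ℕ) : ℤ := if n ∈ A then 1 else -1

lemma thueMorseSign_zero : thueMorseSign 0 = 1 := by
  simp [thueMorseSign, A]

lemma thueMorseSign_two_mul (n : ℕ) : thueMorseSign (2 * n) = thueMorseSign n := by
  rcases Nat.eq_zero_or_pos n with rfl | hn
  · rfl
  · have h : 2 * n ∈ A ↔ n ∈ A := by
      simp only [A, Set.mem_ofPred_eq]
      rw [Nat.digits_def' (by norm_num) (by omega)]
      simp
    by_cases hA : n ∈ A <;> simp [thueMorseSign, h, hA]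

lemma thueMorseSign_two_mul_add_one (n : ℕ) :
    thueMorseSign (2 * n + 1) = -thueMorseSign n := by
  have h : 2 * n + 1 ∈ A ↔ n ∉ A := by
    simp only [A, Set.mem_ofPred_eq]
    rw [Nat.digits_def' (by norm_num) (by omega)]
    have h1 : (2 * n + 1) % 2 = 1 := by omega
    have h2 : (2 * n + 1) / 2 = n := by omega
    rw [h1, h2, List.count_cons_self, Nat.even_add_one]
  by_cases hn : n ∈ A <;> simp [thueMorseSign, h, hn]

lemma thueMorseSign_eq_one_or (n : ℕ) : thueMorseSign n = 1 ∨ thueMorseSign n = -1 := by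
  unfold thueMorseSign
  split_ifs <;> simp

/-- If the Thue–Morse word of length `m + 1` agrees up to sign with its reversal, possibly
except at the last letter, then `m + 1` is a power of two. -/
lemma exists_eq_two_pow_sub_one_of_reflect (m : ℕ)
    (h : ∀ i < m, thueMorseSign (m - i) = thueMorseSign m * thueMorseSign i) :
    ∃ l : ℕ, m = 2 ^ l - 1 := by
  induction m using Nat.strong_induction_on with
  | _ m ih =>
  rcases Nat.eq_zero_or_pos m with rfl | hm
  · exact ⟨0, rfl⟩
  have t1 : thueMorseSign 1 = -1 := by
    simpa [thueMorseSign_zero] using thueMorseSign_two_mul_add_one 0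
  have t2 : thueMorseSign 2 = -1 := by simpa [t1] using thueMorseSign_two_mul 1
  have t3 : thueMorseSign 3 = 1 := by simpa [t1] using thueMorseSign_two_mul_add_one 1
  have hcases : (∃ k, m = 2 * k + 1) ∨ (∃ k, m = 2 * (2 * k + 1)) ∨
      ∃ k, m = 2 * (2 * (k + 1)) := by
    by_cases h1 : m % 2 = 1
    · exact Or.inl ⟨m / 2, by omega⟩
    · by_cases h2 : m % 4 = 2
      · exact Or.inr (Or.inl ⟨m / 4, by omega⟩)
      · exact Or.inr (Or.inr ⟨m / 4 - 1, by omega⟩)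
  rcases hcases with ⟨k, rfl⟩ | ⟨k, rfl⟩ | ⟨k, rfl⟩
  · obtain ⟨l, hl⟩ := ih k (by omega) fun i hi => by
      have := h (2 * i) (by omega)
      rw [show 2 * k + 1 - 2 * i = 2 * (k - i) + 1 by omega, thueMorseSign_two_mul_add_one,
        thueMorseSign_two_mul_add_one, thueMorseSign_two_mul] at this
      linarith
    refine ⟨l + 1, ?_⟩
    have := Nat.one_le_two_pow (n := l)
    rw [pow_succ]
    omega
  · have := h 1 (by omega)
    rw [show 2 * (2 * k + 1) - 1 = 2 * (2 * k) + 1 by omega, thueMorseSign_two_mul_add_one,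
      thueMorseSign_two_mul, thueMorseSign_two_mul, thueMorseSign_two_mul_add_one, t1] at this
    rcases thueMorseSign_eq_one_or k with hk | hk <;> rw [hk] at this <;> norm_num at this
  · have h2 := h 2 (by omega)
    have h3 := h 3 (by omega)
    rw [show 2 * (2 * (k + 1)) - 2 = 2 * (2 * k + 1) by omega, thueMorseSign_two_mul,
      thueMorseSign_two_mul_add_one, t2] at h2
    rw [show 2 * (2 * (k + 1)) - 3 = 2 * (2 * k) + 1 by omega, thueMorseSign_two_mul_add_one,
      thueMorseSign_two_mul, t3] at h3
    rcases thueMorseSign_eq_one_or (2 * (2 * (k + 1))) with hk | hk <;> rw [hk] at h2 h3 <;>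
      linarith

open Classical in
lemma R_inter_Icc_eq_sum (S : Set ℕ) (m j : ℕ) :
    (R (S ∩ Set.Icc 0 m) (m + j) : ℤ) =
      ∑ k ∈ (Finset.Ico j (m + 1)).filter (fun k => 2 * k < m + j),
        if k ∈ S ∧ m + j - k ∈ S then 1 else 0 := by
  have himage : {p : ℕ × ℕ | p.1 ∈ S ∩ Set.Icc 0 m ∧ p.2 ∈ S ∩ Set.Icc 0 m ∧ p.1 < p.2 ∧
      p.1 + p.2 = m + j} = (fun k => (k, m + j - k)) '' ((((Finset.Ico j (m + 1)).filter
        (fun k => 2 * k < m + j)).filter fun k => k ∈ S ∧ m + j - k ∈ S : Finset ℕ) : Set ℕ) := by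
    ext ⟨a, b⟩
    simp only [Set.mem_ofPred_eq, Set.mem_inter_iff, Set.mem_Icc, Set.mem_image, Finset.coe_filter,
      Finset.mem_filter, Finset.mem_Ico, Prod.mk.injEq]
    constructor
    · rintro ⟨⟨ha, -, ham⟩, ⟨hb, -, hbm⟩, hab, hs⟩
      have hb' : m + j - a = b := by omega
      exact ⟨a, ⟨⟨⟨by omega, by omega⟩, by omega⟩, ha, hb' ▸ hb⟩, rfl, hb'⟩
    · rintro ⟨k, ⟨⟨⟨h1, h2⟩, h3⟩, h4, h5⟩, rfl, rfl⟩
      exact ⟨⟨h4, by omega, by omega⟩, ⟨h5, by omega, by omega⟩, by omega, by omega⟩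
  have hinj : Function.Injective fun k : ℕ => (k, m + j - k) := fun a b hab =>
    (Prod.mk.inj hab).1
  rw [R, himage, Set.ncard_image_of_injective _ hinj, Set.ncard_coe_finset, Finset.sum_boole]

lemma two_mul_R_sub_R (m j : ℕ) (hj : j ≤ m) :
    2 * ((R (A ∩ Set.Icc 0 m) (m + j) : ℤ) - R (B ∩ Set.Icc 0 m) (m + j)) =
      ∑ k ∈ Finset.Ico j (m + 1), thueMorseSign k -
        if Even (m + j) then thueMorseSign ((m + j) / 2) else 0 := by
  classical
  have hlt : 2 * ((R (A ∩ Set.Icc 0 m) (m + j) : ℤ) - R (B ∩ Set.Icc 0 m) (m + j)) =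
      ∑ k ∈ (Finset.Ico j (m + 1)).filter (fun k => 2 * k < m + j),
        (thueMorseSign k + thueMorseSign (m + j - k)) := by
    rw [R_inter_Icc_eq_sum, R_inter_Icc_eq_sum, ← Finset.sum_sub_distrib, Finset.mul_sum]
    refine Finset.sum_congr rfl fun k _ => ?_
    by_cases h1 : k ∈ A <;> by_cases h2 : m + j - k ∈ A <;> simp [thueMorseSign, B, h1, h2]
  have hreflect : ∑ k ∈ (Finset.Ico j (m + 1)).filter (fun k => 2 * k < m + j),
        thueMorseSign (m + j - k) =
      ∑ k ∈ (Finset.Ico j (m + 1)).filter (fun k => m + j < 2 * k), thueMorseSign k := by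
    refine Finset.sum_nbij' (fun k => m + j - k) (fun k => m + j - k) ?_ ?_ ?_ ?_ fun _ _ => rfl <;>
      simp only [Finset.mem_filter, Finset.mem_Ico] <;> intros <;> omega
  have hmiddle : (∑ k ∈ Finset.Ico j (m + 1), if 2 * k = m + j then thueMorseSign k else 0) =
      if Even (m + j) then thueMorseSign ((m + j) / 2) else 0 := by
    split_ifs with he
    · obtain ⟨r, hr⟩ := he
      rw [Finset.sum_eq_single r]
      · rw [if_pos (by omega), show (m + j) / 2 = r by omega]
      · intro k _ hk
        exact if_neg (by omega)
      · simp only [Finset.mem_Ico]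
        omega
    · refine Finset.sum_eq_zero fun k _ => if_neg fun hk => he ⟨k, by omega⟩
  rw [hlt, Finset.sum_add_distrib, hreflect, ← hmiddle, Finset.sum_filter, Finset.sum_filter,
    ← Finset.sum_add_distrib, ← Finset.sum_sub_distrib]
  refine Finset.sum_congr rfl fun k _ => ?_
  rcases lt_trichotomy (2 * k) (m + j) with h | h | h
  · simp [h, h.ne, h.le]
  · simp [h]
  · simp [h, h.ne', h.le]

theorem stmt_11 (m : ℕ) (hm : 0 < m) (hform : ¬∃ l : ℕ, m = 2 ^ l - 1)
    (C D : Set ℕ) (hC : C = A ∩ Set.Icc 0 m) (hD : D = B ∩ Set.Icc 0 m) :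
    ∃ n : ℕ, m < n ∧ n < 2 * m ∧ R C n ≠ R D n := by
  by_contra! hR
  subst hC hD
  have hsum : ∀ j, 1 ≤ j → j ≤ m → ∑ k ∈ Finset.Ico j (m + 1), thueMorseSign k =
      if Even (m + j) then thueMorseSign ((m + j) / 2) else 0 := by
    intro j hj hjm
    rcases hjm.eq_or_lt with rfl | hjm
    · simp [show (j + j) / 2 = j by omega]
    · have h := two_mul_R_sub_R m j hjm.le
      rw [hR (m + j) (by omega) (by omega)] at h
      linarith
  have hstep : ∀ j, 1 ≤ j → j < m → thueMorseSign j =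
      (if Even (m + j) then thueMorseSign ((m + j) / 2) else 0) -
        if Even (m + (j + 1)) then thueMorseSign ((m + (j + 1)) / 2) else 0 := by
    intro j hj hjm
    have h := Finset.sum_eq_sum_Ico_succ_bot (show j < m + 1 by omega) thueMorseSign
    rw [hsum j hj hjm.le, hsum (j + 1) (by omega) hjm] at h
    linarith
  refine hform (exists_eq_two_pow_sub_one_of_reflect m fun i => ?_)
  induction i using Nat.strong_induction_on with
  | _ i ih =>
  intro hi
  rcases Nat.eq_zero_or_pos i with rfl | hpos
  · simp [thueMorseSign_zero]
  have h := hstep (m - i) (by omega) (by omega)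
  rcases Nat.even_or_odd' i with ⟨r, rfl | rfl⟩
  · rw [if_pos ⟨m - r, by omega⟩, if_neg (by rw [Nat.even_iff]; omega),
      show (m + (m - 2 * r)) / 2 = m - r by omega, ih r (by omega) (by omega)] at h
    rw [h, thueMorseSign_two_mul, sub_zero]
  · rw [if_neg (by rw [Nat.even_iff]; omega), if_pos ⟨m - r, by omega⟩,
      show (m + (m - (2 * r + 1) + 1)) / 2 = m - r by omega, ih r (by omega) (by omega)] at h
    rw [h, thueMorseSign_two_mul_add_one]
    ring
end

section
/- Let C and D be two sets of nonnegative integers such that C ∪ D = [0, m] \ {1} with m ≥ 2, C ∩ D = ∅, 0 ∈ C, and R_C(n) = R_D(n) for every nonnegative integer n. Then m = 2. -/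
open Finset in
lemma sum_antidiagonal_indicator_mul_indicator (S : Set ℕ) (n : ℕ) :
    ∑ x ∈ antidiagonal n, S.indicator (1 : ℕ → ℤ) x.1 * S.indicator 1 x.2 =
      2 * (R S n : ℤ) + if Even n then S.indicator 1 (n / 2) else 0 := by
  classical
  set f : ℕ × ℕ → ℤ := fun x => S.indicator (1 : ℕ → ℤ) x.1 * S.indicator 1 x.2 with hf
  have h_lt : ∑ x ∈ antidiagonal n with x.1 < x.2, f x = R S n := by
    have hset : {p : ℕ × ℕ | p.1 ∈ S ∧ p.2 ∈ S ∧ p.1 < p.2 ∧ p.1 + p.2 = n} =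
        ↑({x ∈ {x ∈ antidiagonal n | x.1 < x.2} | x.1 ∈ S ∧ x.2 ∈ S}) := by
      ext x
      simp only [Set.mem_ofPred_eq, coe_filter, mem_filter, HasAntidiagonal.mem_antidiagonal]
      tauto
    rw [R, hset, Set.ncard_coe_finset, card_filter, Nat.cast_sum]
    refine sum_congr rfl fun x _ => ?_
    by_cases h₁ : x.1 ∈ S <;> by_cases h₂ : x.2 ∈ S <;> simp [hf, h₁, h₂]
  have h_gt : ∑ x ∈ antidiagonal n with x.2 < x.1, f x = R S n := by
    rw [← h_lt]
    refine sum_nbij' Prod.swap Prod.swap ?_ ?_ ?_ ?_ ?_ <;>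
      simp +contextual [hf, mul_comm, add_comm]
  have h_eq : ∑ x ∈ antidiagonal n with x.1 = x.2, f x =
      if Even n then S.indicator 1 (n / 2) else 0 := by
    split_ifs with hn
    · have hsing : {x ∈ antidiagonal n | x.1 = x.2} = {(n / 2, n / 2)} := by
        ext ⟨a, b⟩
        simp only [mem_filter, HasAntidiagonal.mem_antidiagonal, mem_singleton, Prod.mk.injEq]
        obtain ⟨k, rfl⟩ := hn
        omega
      rw [hsing, sum_singleton]
      by_cases h : n / 2 ∈ S <;> simp [hf, h]
    · rw [filter_eq_empty_iff.2, sum_empty]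
      rintro ⟨a, b⟩ hab (rfl : a = b)
      exact hn ⟨a, (HasAntidiagonal.mem_antidiagonal.1 hab).symm⟩
  have h_split : ∀ x : ℕ × ℕ, f x = (if x.1 < x.2 then f x else 0) +
      (if x.2 < x.1 then f x else 0) + if x.1 = x.2 then f x else 0 := by
    intro x
    rcases lt_trichotomy x.1 x.2 with h | h | h
    · simp [h, h.ne, h.not_gt]
    · simp [h]
    · simp [h, h.ne', h.not_gt]
  rw [sum_congr rfl fun x _ => h_split x, sum_add_distrib, sum_add_distrib, ← sum_filter,
    ← sum_filter, ← sum_filter, h_lt, h_gt, h_eq]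
  ring

open Finset in
lemma sum_antidiagonal_indicator_sub_mul_add {C D : Set ℕ} {n : ℕ} (hR : R C n = R D n) :
    ∑ x ∈ antidiagonal n, (C.indicator (1 : ℕ → ℤ) x.1 - D.indicator 1 x.1) *
        (C.indicator 1 x.2 + D.indicator 1 x.2) =
      if Even n then C.indicator 1 (n / 2) - D.indicator 1 (n / 2) else 0 := by
  have hC := sum_antidiagonal_indicator_mul_indicator C n
  have hD := sum_antidiagonal_indicator_mul_indicator D n
  have hswap : ∑ x ∈ antidiagonal n, C.indicator (1 : ℕ → ℤ) x.1 * D.indicator 1 x.2 =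
      ∑ x ∈ antidiagonal n, D.indicator (1 : ℕ → ℤ) x.1 * C.indicator 1 x.2 := by
    rw [← Nat.sum_antidiagonal_swap]
    simp [mul_comm]
  simp only [sub_mul, mul_add, sum_sub_distrib, sum_add_distrib]
  rw [hC, hD, hswap, hR]
  split_ifs <;> ring

open Finset in
/-- The low-order coefficients of the product of `p` with the indicator of `[0, m] \ {1}`. -/
lemma sum_antidiagonal_mul_eq_sum_range_sub {m n : ℕ} {p s : ℕ → ℤ} (hs1 : s 1 = 0)
    (hs : ∀ j ≤ m, j ≠ 1 → s j = 1) (hn : 1 ≤ n) (hnm : n ≤ m) :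
    ∑ x ∈ antidiagonal n, p x.1 * s x.2 = ∑ i ∈ range (n + 1), p i - p (n - 1) := by
  rw [Nat.sum_antidiagonal_eq_sum_range_succ fun i j => p i * s j, eq_sub_iff_add_eq,
    ← sum_ite_eq' (range (n + 1)) (n - 1) p |>.trans (if_pos (mem_range.2 (by omega))),
    ← sum_add_distrib]
  refine sum_congr rfl fun i hi => ?_
  have hi' := mem_range.1 hi
  split_ifs with h
  · have : n - i = 1 := by omega
    simp [this, hs1]
  · simp [hs (n - i) (by omega) (by omega)]

open Finset in
/-- The high-order coefficients of the product of `p` with the indicator of `[0, m] \ {1}`. -/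
lemma sum_antidiagonal_mul_eq_sum_range_rev {m k : ℕ} {p s : ℕ → ℤ}
    (hs : ∀ j ≤ m, j ≠ 1 → s j = 1) (hp : ∀ j, m < j → p j = 0) (hs0 : ∀ j, m < j → s j = 0)
    (hk : k + 2 ≤ m) :
    ∑ x ∈ antidiagonal (2 * m - k), p x.1 * s x.2 = ∑ i ∈ range (k + 1), p (m - i) := by
  symm
  refine sum_of_injOn (fun i => (m - i, m - k + i)) ?_ ?_ ?_ ?_
  · intro i hi j hj hij
    simp only [coe_range, Set.mem_Iio, Prod.mk.injEq] at hi hj hij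
    omega
  · intro i hi
    simp only [coe_range, Set.mem_Iio, mem_coe, HasAntidiagonal.mem_antidiagonal] at hi ⊢
    omega
  · rintro ⟨a, b⟩ hab h
    rw [HasAntidiagonal.mem_antidiagonal] at hab
    dsimp only at hab ⊢
    by_cases ha : m < a
    · rw [hp a ha, zero_mul]
    by_cases hb : m < b
    · rw [hs0 b hb, mul_zero]
    refine absurd ⟨m - a, ?_, ?_⟩ h
    · simp only [coe_range, Set.mem_Iio]
      omega
    · simp only [Prod.mk.injEq]
      omega
  · intro i hi
    have hi' := mem_range.1 hi
    rw [hs (m - k + i) (by omega) (by omega), mul_one]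

/-- A sequence supported on `[0, m] \ {1}` whose product with the indicator of that set is the
dilation of the sequence by two, and which does not vanish at `m`, forces `m = 2`. -/
lemma eq_two_of_sum_antidiagonal_eq {m : ℕ} (hm : 2 ≤ m) {p s : ℕ → ℤ} (hs1 : s 1 = 0)
    (hs : ∀ j ≤ m, j ≠ 1 → s j = 1) (hp : ∀ j, m < j → p j = 0) (hs0 : ∀ j, m < j → s j = 0)
    (hp1 : p 1 = 0) (hpm : p m ≠ 0)
    (h : ∀ n, ∑ x ∈ Finset.HasAntidiagonal.antidiagonal n, p x.1 * s x.2 = if Even n then p (n / 2) else 0) :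
    m = 2 := by
  have hlow : ∀ n, 1 ≤ n → n ≤ m →
      ∑ i ∈ Finset.range (n + 1), p i - p (n - 1) = if Even n then p (n / 2) else 0 :=
    fun n hn hnm => (sum_antidiagonal_mul_eq_sum_range_sub hs1 hs hn hnm).symm.trans (h n)
  have htop : ∀ k, k + 2 ≤ m → ∑ i ∈ Finset.range (k + 1), p (m - i) =
      if Even (2 * m - k) then p ((2 * m - k) / 2) else 0 :=
    fun k hk => (sum_antidiagonal_mul_eq_sum_range_rev hs hp hs0 hk).symm.trans (h _)
  have hodd : ∀ n, n + 3 ≤ m → Even n → p (n + 3) + p n = 0 := by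
    intro n hn he
    have h₁ := hlow (n + 1) (by omega) (by omega)
    have h₃ := hlow (n + 3) (by omega) hn
    rw [if_neg (by grind)] at h₁ h₃
    simp only [Finset.sum_range_succ, Nat.add_sub_cancel, Nat.add_succ_sub_one] at h₁ h₃
    linarith
  have hrev1 : 3 ≤ m → p m + p (m - 1) = 0 := by
    intro h3
    have := htop 1 (by omega)
    rw [if_neg (by grind)] at this
    simpa [Finset.sum_range_succ] using this
  have hrev2 : 4 ≤ m → p m + p (m - 2) = 0 := by
    intro h4
    have := htop 2 (by omega)
    rw [if_pos (by grind), show (2 * m - 2) / 2 = m - 1 by omega] at this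
    simp only [Finset.sum_range_succ, Finset.sum_range_zero, Nat.sub_zero] at this
    linarith [hrev1 (by omega)]
  have hrev3 : 5 ≤ m → p (m - 3) = p m := by
    intro h5
    have := htop 3 (by omega)
    rw [if_neg (by grind)] at this
    simp only [Finset.sum_range_succ, Finset.sum_range_zero, Nat.sub_zero] at this
    linarith [hrev1 (by omega), hrev2 (by omega)]
  have hrev4 : 6 ≤ m → p (m - 4) = p (m - 1) := by
    intro h6
    have := htop 4 (by omega)
    rw [if_pos (by grind), show (2 * m - 4) / 2 = m - 2 by omega] at this
    simp only [Finset.sum_range_succ, Finset.sum_range_zero, Nat.sub_zero] at this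
    linarith [hrev1 (by omega), hrev2 (by omega), hrev3 (by omega)]
  have hp2 : p 2 = - p 0 := by
    have := hlow 2 (by omega) hm
    simp [Finset.sum_range_succ, hp1] at this
    linarith
  by_contra hm2
  obtain rfl | rfl | hm5 : m = 3 ∨ m = 4 ∨ 5 ≤ m := by omega
  · have h₁ := hrev1 le_rfl
    have h₂ := hodd 0 le_rfl (by decide)
    simp only [Nat.reduceSub, zero_add] at h₁ h₂
    omega
  · have h₁ := hrev2 le_rfl
    have h₂ := hlow 4 (by omega) le_rfl
    rw [if_pos (by decide)] at h₂
    simp only [Finset.sum_range_succ, Finset.sum_range_zero, Nat.reduceSub, Nat.reduceDiv] at h₁ h₂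
    omega
  · rcases Nat.even_or_odd m with he | ho
    · have h₁ := hodd (m - 4) (by grind) (by grind)
      rw [show m - 4 + 3 = m - 1 by omega, hrev4 (by grind)] at h₁
      have h₂ := hrev1 (by omega)
      omega
    · have h₁ := hodd (m - 3) (by omega) (by grind)
      rw [show m - 3 + 3 = m by omega, hrev3 hm5] at h₁
      omega

theorem stmt_13 (m : ℕ) (hm : 2 ≤ m) (C D : Set ℕ)
    (hCD : C ∪ D = Set.Icc 0 m \ {1}) (hdisj : C ∩ D = ∅) (h0C : 0 ∈ C)
    (hR : ∀ n : ℕ, R C n = R D n) :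
    m = 2 := by
  have hunion : ∀ j, j ∈ C ∨ j ∈ D ↔ j ≤ m ∧ j ≠ 1 := fun j => by
    rw [← Set.mem_union, hCD]
    simp
  have hinter : ∀ j, j ∈ C → j ∉ D := fun j hC hD => by
    simpa [hdisj] using Set.mem_inter hC hD
  have hout : ∀ j, ¬(j ≤ m ∧ j ≠ 1) → j ∉ C ∧ j ∉ D := fun j hj => by
    rwa [← not_or, hunion]
  have hne : ∀ j ≤ m, j ≠ 1 → C.indicator (1 : ℕ → ℤ) j - D.indicator 1 j ≠ 0 ∧
      C.indicator (1 : ℕ → ℤ) j + D.indicator 1 j = 1 := by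
    intro j hj hj1
    rcases (hunion j).2 ⟨hj, hj1⟩ with h | h
    · simp [h, hinter j h]
    · have hC : j ∉ C := fun hC => hinter j hC h
      simp [h, hC]
  refine eq_two_of_sum_antidiagonal_eq hm
    (p := fun j => C.indicator 1 j - D.indicator 1 j)
    (s := fun j => C.indicator 1 j + D.indicator 1 j) ?_ (fun j hj hj1 => (hne j hj hj1).2)
    ?_ ?_ ?_ (hne m le_rfl (by omega)).1
    (fun n => sum_antidiagonal_indicator_sub_mul_add (hR n))
  · simp [hout 1 (by omega)]
  · intro j hj
    simp [hout j (by omega)]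
  · intro j hj
    simp [hout j (by omega)]
  · simp [hout 1 (by omega)]
end

section
/- Let C and D be two sets of nonnegative integers such that C ∪ D = [0, m] \ {4} with m ≥ 5, C ∩ D = ∅, 0 ∈ C, and R_C(n) = R_D(n) for every nonnegative integer n. Then m = 8, C = {0, 3, 6, 7}, and D = {1, 2, 5, 8}. -/
open Classical in
theorem R_eq_sum (S : Set ℕ) (n : ℕ) :
    R S n = ∑ i ∈ Finset.range ((n + 1) / 2), if i ∈ S ∧ n - i ∈ S then 1 else 0 := by
  rw [← Finset.card_filter, R, ← Set.ncard_coe_finset]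
  refine Set.ncard_congr (fun p _ => p.1) ?_ ?_ ?_
  · rintro ⟨a, b⟩ ⟨ha, hb, hab, hn⟩
    simp only at ha hb hab hn
    have h : n - a = b := by omega
    simp only [Finset.coe_filter, Finset.mem_range, Set.mem_ofPred_eq, h]
    exact ⟨by omega, ha, hb⟩
  · rintro ⟨a, b⟩ ⟨a', b'⟩ ⟨-, -, -, h⟩ ⟨-, -, -, h'⟩ haa
    simp only at h h' haa
    ext <;> simp only <;> omega
  · intro a ha
    simp only [Finset.coe_filter, Finset.mem_range, Set.mem_ofPred_eq] at ha
    exact ⟨(a, n - a), ⟨ha.2.1, ha.2.2, by simp only; omega, by simp only; omega⟩, rfl⟩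

set_option linter.unusedSimpArgs false in
theorem stmt_14 (m : ℕ) (hm : 5 ≤ m) (C D : Set ℕ)
    (hCD : C ∪ D = Set.Icc 0 m \ {4}) (hdisj : C ∩ D = ∅) (h0C : 0 ∈ C)
    (hR : ∀ n : ℕ, R C n = R D n) :
    m = 8 ∧ C = ({0, 3, 6, 7} : Set ℕ) ∧ D = ({1, 2, 5, 8} : Set ℕ) := by
  classical
  have hD (i : ℕ) : i ∈ D ↔ (i ≤ m ∧ i ≠ 4) ∧ i ∉ C := by
    have h₁ := Set.ext_iff.mp hCD i
    have h₂ := Set.ext_iff.mp hdisj i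
    simp only [Set.mem_union, Set.mem_sdiff, Set.mem_Icc, Set.mem_singleton_iff, Set.mem_inter_iff,
      Set.mem_empty_iff_false] at h₁ h₂
    grind
  have hC (i : ℕ) (hi : i ∈ C) : i ≤ m ∧ i ≠ 4 := by
    have h := Set.ext_iff.mp hCD i
    simpa [hi] using h
  have hgt (i : ℕ) (hi : m < i) : i ∉ C := fun h => absurd (hC i h).1 (by omega)
  have h4 : 4 ∉ C := fun h => (hC 4 h).2 rfl
  simp only [R_eq_sum, hD] at hR
  have h1 : 1 ∉ C := by
    have := hR 1
    have hle (i : ℕ) (hi : i ≤ 1) : i ≤ m := by omega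
    by_contra h
    simp [-Finset.sum_boole, Finset.sum_range_succ, hle, h, h0C, h4] at this
  have h2 : 2 ∉ C := by
    have := hR 2
    have hle (i : ℕ) (hi : i ≤ 2) : i ≤ m := by omega
    by_contra h
    simp [-Finset.sum_boole, Finset.sum_range_succ, hle, h, h0C, h4, h1] at this
  have h3 : 3 ∈ C := by
    have := hR 3
    have hle (i : ℕ) (hi : i ≤ 3) : i ≤ m := by omega
    by_contra h
    simp [-Finset.sum_boole, Finset.sum_range_succ, hle, h, h0C, h4, h1, h2] at this
  have h5 : 5 ∉ C := by
    have := hR 5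
    have hle (i : ℕ) (hi : i ≤ 5) : i ≤ m := by omega
    by_contra h
    simp [-Finset.sum_boole, Finset.sum_range_succ, hle, h, h0C, h4, h1, h2, h3] at this
  obtain rfl | hm := Nat.eq_or_lt_of_le hm
  · have := hR 7
    simp [-Finset.sum_boole, Finset.sum_range_succ, hgt, h0C, h4, h1, h2, h3, h5] at this
  have h6 : 6 ∈ C := by
    have := hR 6
    have hle (i : ℕ) (hi : i ≤ 6) : i ≤ m := by omega
    by_contra h
    simp [-Finset.sum_boole, Finset.sum_range_succ, hle, h, h0C, h4, h1, h2, h3, h5] at this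
  obtain rfl | hm := Nat.eq_or_lt_of_le hm
  · have := hR 9
    simp [-Finset.sum_boole, Finset.sum_range_succ, hgt, h0C, h4, h1, h2, h3, h5, h6] at this
  have h7 : 7 ∈ C := by
    have := hR 7
    have hle (i : ℕ) (hi : i ≤ 7) : i ≤ m := by omega
    by_contra h
    simp [-Finset.sum_boole, Finset.sum_range_succ, hle, h, h0C, h4, h1, h2, h3, h5, h6] at this
  obtain rfl | hm := Nat.eq_or_lt_of_le hm
  · have := hR 13
    simp [-Finset.sum_boole, Finset.sum_range_succ, hgt, h0C, h4, h1, h2, h3, h5, h6, h7] at this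
  have h8 : 8 ∉ C := by
    have := hR 8
    have hle (i : ℕ) (hi : i ≤ 8) : i ≤ m := by omega
    by_contra h
    simp [-Finset.sum_boole, Finset.sum_range_succ, hle, h, h0C, h4, h1, h2, h3, h5, h6, h7] at this
  obtain rfl | hm := Nat.eq_or_lt_of_le hm
  · refine ⟨rfl, ?_, ?_⟩ <;> ext i <;> obtain hi | hi := le_or_gt i 8
    · interval_cases i <;> simp [*]
    · simp only [hgt i hi, Set.mem_insert_iff, Set.mem_singleton_iff, false_iff]
      omega
    · interval_cases i <;> simp [*]
    · simp only [hD, Set.mem_insert_iff, Set.mem_singleton_iff]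
      omega
  have h9 : 9 ∉ C := by
    have := hR 9
    have hle (i : ℕ) (hi : i ≤ 9) : i ≤ m := by omega
    by_contra h
    simp [-Finset.sum_boole, Finset.sum_range_succ, hle, h, h0C, h4, h1, h2, h3, h5, h6, h7, h8] at this
  obtain rfl | hm := Nat.eq_or_lt_of_le hm
  · have := hR 17
    simp [-Finset.sum_boole, Finset.sum_range_succ, hgt, h0C, h4, h1, h2, h3, h5, h6, h7, h8, h9] at this
  have h10 : 10 ∈ C := by
    have := hR 10
    have hle (i : ℕ) (hi : i ≤ 10) : i ≤ m := by omega
    by_contra h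
    simp [-Finset.sum_boole, Finset.sum_range_succ, hle, h, h0C, h4, h1, h2, h3, h5, h6, h7, h8, h9] at this
  obtain rfl | hm := Nat.eq_or_lt_of_le hm
  · have := hR 16
    simp [-Finset.sum_boole, Finset.sum_range_succ, hgt, h0C, h4, h1, h2, h3, h5, h6, h7, h8, h9, h10] at this
  have h11 : 11 ∈ C := by
    have := hR 11
    have hle (i : ℕ) (hi : i ≤ 11) : i ≤ m := by omega
    by_contra h
    simp [-Finset.sum_boole, Finset.sum_range_succ, hle, h, h0C, h4, h1, h2, h3, h5, h6, h7, h8, h9, h10] at this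
  obtain rfl | hm := Nat.eq_or_lt_of_le hm
  · have := hR 21
    simp [-Finset.sum_boole, Finset.sum_range_succ, hgt, h0C, h4, h1, h2, h3, h5, h6, h7, h8, h9, h10, h11] at this
  have h12 : 12 ∉ C := by
    have := hR 12
    have hle (i : ℕ) (hi : i ≤ 12) : i ≤ m := by omega
    by_contra h
    simp [-Finset.sum_boole, Finset.sum_range_succ, hle, h, h0C, h4, h1, h2, h3, h5, h6, h7, h8, h9, h10, h11] at this
  obtain rfl | hm := Nat.eq_or_lt_of_le hm
  · have := hR 20
    simp [-Finset.sum_boole, Finset.sum_range_succ, hgt, h0C, h4, h1, h2, h3, h5, h6, h7, h8, h9, h10, h11, h12] at this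
  have h13 : 13 ∉ C := by
    have := hR 13
    have hle (i : ℕ) (hi : i ≤ 13) : i ≤ m := by omega
    by_contra h
    simp [-Finset.sum_boole, Finset.sum_range_succ, hle, h, h0C, h4, h1, h2, h3, h5, h6, h7, h8, h9, h10, h11, h12] at this
  obtain rfl | hm := Nat.eq_or_lt_of_le hm
  · have := hR 25
    simp [-Finset.sum_boole, Finset.sum_range_succ, hgt, h0C, h4, h1, h2, h3, h5, h6, h7, h8, h9, h10, h11, h12, h13] at this
  have := hR 14
  have hle (i : ℕ) (hi : i ≤ 14) : i ≤ m := by omega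
  by_cases h14 : 14 ∈ C <;>
    simp [-Finset.sum_boole, Finset.sum_range_succ, hle, h14, h0C, h4, h1, h2, h3, h5, h6, h7, h8, h9, h10, h11, h12, h13] at this
end

section
/- Let C and D be two sets of nonnegative integers such that C ∪ D = [0, m] \ {r} with 6 ≤ r ≤ m/2, C ∩ D = ∅, 0 ∈ C, and R_C(n) = R_D(n) for every nonnegative integer n. Then r is even. -/
open Finset in
/-- Counting ordered representations of `n` as a sum of two elements of `S`. -/
theorem sum_indicator_mul_indicator (S : Set ℕ) (n : ℕ) :
    ∑ p ∈ antidiagonal n, S.indicator (1 : ℕ → ℤ) p.1 * S.indicator (1 : ℕ → ℤ) p.2 =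
      2 * (R S n : ℤ) + if Even n then S.indicator (1 : ℕ → ℤ) (n / 2) else 0 := by
  classical
  set s : ℕ → ℤ := S.indicator 1 with hs
  have h_lt : ∑ p ∈ antidiagonal n with p.1 < p.2, s p.1 * s p.2 = R S n := by
    have h_set : {p : ℕ × ℕ | p.1 ∈ S ∧ p.2 ∈ S ∧ p.1 < p.2 ∧ p.1 + p.2 = n} =
        (((antidiagonal n).filter (fun p => p.1 < p.2)).filter
          (fun p => p.1 ∈ S ∧ p.2 ∈ S) : Finset (ℕ × ℕ)) := by
      ext p
      simp only [Set.mem_ofPred_eq, coe_filter, mem_filter, HasAntidiagonal.mem_antidiagonal]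
      tauto
    rw [R, h_set, Set.ncard_coe_finset, card_filter]
    push_cast
    refine sum_congr rfl fun p _ => ?_
    by_cases h1 : p.1 ∈ S <;> by_cases h2 : p.2 ∈ S <;> simp [hs, h1, h2]
  have h_gt : ∑ p ∈ antidiagonal n with p.2 < p.1, s p.1 * s p.2 = R S n := by
    rw [← h_lt]
    refine sum_nbij' Prod.swap Prod.swap ?_ ?_ ?_ ?_ ?_ <;>
      simp +contextual [add_comm, mul_comm]
  have h_eq : ∑ p ∈ antidiagonal n with p.1 = p.2, s p.1 * s p.2 =
      if Even n then s (n / 2) else 0 := by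
    split_ifs with h_even
    · obtain ⟨k, rfl⟩ := h_even
      have h_single : (antidiagonal (k + k)).filter (fun p => p.1 = p.2) = {(k, k)} := by
        ext ⟨a, b⟩
        simp only [mem_filter, HasAntidiagonal.mem_antidiagonal, mem_singleton, Prod.mk.injEq]
        omega
      rw [h_single, sum_singleton, show (k + k) / 2 = k by omega]
      by_cases h : k ∈ S <;> simp [hs, h]
    · refine sum_eq_zero fun p hp => absurd ?_ h_even
      simp only [mem_filter, HasAntidiagonal.mem_antidiagonal] at hp
      exact ⟨p.1, by omega⟩
  have h_split : ∀ p : ℕ × ℕ, s p.1 * s p.2 =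
      (if p.1 < p.2 then s p.1 * s p.2 else 0) + (if p.2 < p.1 then s p.1 * s p.2 else 0) +
        (if p.1 = p.2 then s p.1 * s p.2 else 0) := by
    intro p
    rcases lt_trichotomy p.1 p.2 with h | h | h
    · simp [h, h.not_gt, h.ne]
    · simp [h]
    · simp [h, h.not_gt, h.ne']
  rw [sum_congr rfl fun p _ => h_split p, sum_add_distrib, sum_add_distrib, ← sum_filter,
    ← sum_filter, ← sum_filter, h_lt, h_gt, h_eq]
  ring

open Finset in
/-- If `R_C = R_D`, the generating functions satisfy
`(C(x) - D(x)) (C(x) + D(x)) = C(x²) - D(x²)`. -/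
theorem sum_sub_mul_add_of_R_eq {C D : Set ℕ} (hR : ∀ n, R C n = R D n) (n : ℕ) :
    ∑ p ∈ antidiagonal n,
        (C.indicator (1 : ℕ → ℤ) p.1 - D.indicator 1 p.1) *
          (C.indicator 1 p.2 + D.indicator 1 p.2) =
      if Even n then C.indicator (1 : ℕ → ℤ) (n / 2) - D.indicator 1 (n / 2) else 0 := by
  have hC := sum_indicator_mul_indicator C n
  have hD := sum_indicator_mul_indicator D n
  have h_swap := Nat.sum_antidiagonal_swap (n := n)
    (f := fun p => C.indicator (1 : ℕ → ℤ) p.1 * D.indicator (1 : ℕ → ℤ) p.2)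
  simp only [Prod.fst_swap, Prod.snd_swap] at h_swap
  have h_expand : ∀ p : ℕ × ℕ, (C.indicator (1 : ℕ → ℤ) p.1 - D.indicator 1 p.1) *
      (C.indicator 1 p.2 + D.indicator 1 p.2) =
      C.indicator 1 p.1 * C.indicator 1 p.2 - D.indicator 1 p.1 * D.indicator 1 p.2 +
        (C.indicator 1 p.1 * D.indicator 1 p.2 - C.indicator 1 p.2 * D.indicator 1 p.1) :=
    fun p => by ring
  rw [sum_congr rfl fun p _ => h_expand p, sum_add_distrib, sum_sub_distrib, sum_sub_distrib,
    hC, hD, h_swap, hR n]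
  split_ifs <;> ring

open Finset in
/-- The partial sums of the difference of the indicators of `C` and `D`, when `C` and `D`
partition `[0, m] \ {r}` and `R_C = R_D`. -/
theorem sum_range_sub_of_R_eq {m r : ℕ} {C D : Set ℕ}
    (hCD : C ∪ D = Set.Icc 0 m \ {r}) (hdisj : C ∩ D = ∅) (hR : ∀ n, R C n = R D n)
    {f : ℕ → ℤ} (hf : f = fun i => C.indicator 1 i - D.indicator 1 i) {n : ℕ} (hn : n ≤ m) :
    ∑ i ∈ range (n + 1), f i =
      (if r ≤ n then f (n - r) else 0) + if Even n then f (n / 2) else 0 := by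
  have h := sum_sub_mul_add_of_R_eq hR n
  have h_add : ∀ j ≤ m, C.indicator (1 : ℕ → ℤ) j + D.indicator 1 j =
      if j = r then 0 else 1 := by
    intro j hj
    have h_union : (C ∪ D).indicator (1 : ℕ → ℤ) j = C.indicator 1 j + D.indicator 1 j :=
      congrFun (Set.indicator_union_of_disjoint (Set.disjoint_iff_inter_eq_empty.2 hdisj) 1) j
    rw [← h_union, hCD]
    by_cases hjr : j = r <;> simp [hjr, hj]
  have h_term : ∀ i ∈ range (n + 1), (C.indicator (1 : ℕ → ℤ) i - D.indicator 1 i) *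
      (C.indicator 1 (n - i) + D.indicator 1 (n - i)) = f i - if n - i = r then f i else 0 := by
    intro i _
    rw [h_add (n - i) (by omega), hf]
    split_ifs <;> ring
  have h_point : ∑ i ∈ range (n + 1), (if n - i = r then f i else 0) =
      if r ≤ n then f (n - r) else 0 := by
    split_ifs with hrn
    · rw [sum_eq_single (n - r)]
      · rw [if_pos (by omega)]
      · intro i hi hne
        rw [mem_range] at hi
        rw [if_neg (by omega)]
      · intro hi
        rw [mem_range] at hi
        omega
    · exact sum_eq_zero fun i _ => if_neg (by omega)
  rw [Nat.sum_antidiagonal_eq_sum_range_succ_mk, sum_congr rfl h_term, sum_sub_distrib,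
    h_point] at h
  rw [show f (n / 2) = C.indicator (1 : ℕ → ℤ) (n / 2) - D.indicator 1 (n / 2) by rw [hf], ← h]
  ring

theorem stmt_16 (m r : ℕ) (hr6 : 6 ≤ r) (hrm : 2 * r ≤ m) (C D : Set ℕ)
    (hCD : C ∪ D = Set.Icc 0 m \ {r}) (hdisj : C ∩ D = ∅) (h0C : 0 ∈ C)
    (hR : ∀ n : ℕ, R C n = R D n) :
    Even r := by
  set f : ℕ → ℤ := fun i => C.indicator 1 i - D.indicator 1 i with hf
  have h_sum : ∀ n ≤ m, ∑ i ∈ Finset.range (n + 1), f i =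
      (if r ≤ n then f (n - r) else 0) + if Even n then f (n / 2) else 0 :=
    fun n hn => sum_range_sub_of_R_eq hCD hdisj hR hf hn
  have h_mem : ∀ i, (i ∈ C ∨ i ∈ D) ↔ i ≤ m ∧ i ≠ r := fun i => by
    simpa using Set.ext_iff.1 hCD i
  have h_not_both : ∀ i, i ∈ C → i ∉ D := fun i hC hD => by
    simpa using (Set.ext_iff.1 hdisj i).1 ⟨hC, hD⟩
  have h_sign : ∀ i ≤ m, i ≠ r → f i = 1 ∨ f i = -1 := by
    intro i him hir
    rcases (h_mem i).2 ⟨him, hir⟩ with h | h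
    · simp [hf, h, h_not_both i h]
    · have hC : i ∉ C := fun hC => h_not_both i hC h
      simp [hf, h, hC]
  have hf0 : f 0 = 1 := by simp [hf, h0C, h_not_both 0 h0C]
  have hfr : f r = 0 := by
    have h := (not_congr (h_mem r)).2 (by simp)
    rw [not_or] at h
    simp [hf, h.1, h.2]
  have h_sum_even : ∀ i, 2 * i < r → ∑ j ∈ Finset.range (2 * i + 1), f j = f i := by
    intro i hi
    rw [h_sum _ (by omega), if_neg (by omega), if_pos (by simp), zero_add]
    congr 1
    omega
  have h_sum_odd : ∀ i, 2 * i + 1 < r → ∑ j ∈ Finset.range (2 * i + 2), f j = 0 := by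
    intro i hi
    rw [h_sum _ (by omega), if_neg (by omega), if_neg (by simp), zero_add]
  have h_odd : ∀ i, 2 * i + 1 < r → f (2 * i + 1) = -f i := by
    intro i hi
    have h := h_sum_odd i hi
    rw [Finset.sum_range_succ, h_sum_even i (by omega)] at h
    omega
  have h_even : ∀ i, 2 * i < r → f (2 * i) = f i := by
    intro i hi
    obtain _ | i := i
    · rfl
    · have h := h_sum_even (i + 1) hi
      rw [Finset.sum_range_succ, show 2 * (i + 1) = 2 * i + 2 by ring,
        h_sum_odd i (by omega)] at h
      rw [show 2 * (i + 1) = 2 * i + 2 by ring]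
      omega
  by_contra hr_odd
  obtain ⟨k, rfl⟩ := Nat.not_even_iff_odd.1 hr_odd
  have h_shift_even : ∀ i, i ≤ k → ∑ j ∈ Finset.range (2 * k + 1 + 2 * i + 1), f j = f (2 * i) := by
    intro i hi
    rw [h_sum _ (by omega), if_pos (by omega), if_neg (by grind), add_zero]
    congr 1
    omega
  have h_shift : ∀ i, i < k → f (k + 1 + i) = f i := by
    intro i hi
    have h := h_sum (2 * k + 1 + 2 * i + 1) (by omega)
    rw [Finset.sum_range_succ, h_shift_even i hi.le, if_pos (by omega), if_pos (by grind),
      show 2 * k + 1 + 2 * i + 1 - (2 * k + 1) = 2 * i + 1 by omega,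
      show (2 * k + 1 + 2 * i + 1) / 2 = k + 1 + i by omega, h_even i (by omega),
      h_odd i (by omega)] at h
    have h1 := h_sign (2 * k + 1 + 2 * i + 1) (by omega) (by omega)
    have h2 := h_sign (k + 1 + i) (by omega) (by omega)
    have h3 := h_sign i (by omega) (by omega)
    omega
  have hfk : f k = 1 := by
    have h := h_shift_even 0 (by omega)
    rw [mul_zero, add_zero, Finset.sum_range_succ, h_sum_even k (by omega), hfr, hf0] at h
    omega
  obtain ⟨j, hj | hj⟩ := Nat.even_or_odd' k
  · have h1 := h_shift 0 (by omega)
    have h2 := h_odd j (by omega)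
    have h3 := h_even j (by omega)
    rw [← hj] at h2 h3
    rw [add_zero] at h1
    omega
  · have h1 := h_shift (2 * j) (by omega)
    have h2 := h_even k (by omega)
    have h3 := h_odd j (by omega)
    have h4 := h_even j (by omega)
    rw [show k + 1 + 2 * j = 2 * k by omega] at h1
    rw [← hj] at h3
    omega
end

section
/- Let C and D be two sets of nonnegative integers such that C ∪ D = [0, m] \ {r} with 6 ≤ r ≤ m/2, C ∩ D = ∅, 0 ∈ C, and R_C(n) = R_D(n) for every nonnegative integer n. Then r = 2^{l−1} for some integer l ≥ 2, and C ∩ [0, 2r] = A_{l−1} ∪ (2^{l−1} + 1 + B_{l−1}) and D ∩ [0, 2r] = B_{l−1} ∪ (2^{l−1} + 1 + A_{l−1}). -/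
open Finset in
theorem sum_antidiagonal_indicator_mul (S : Set ℕ) (n : ℕ) :
    ∑ x ∈ antidiagonal n, S.indicator (1 : ℕ → ℤ) x.1 * S.indicator (1 : ℕ → ℤ) x.2 =
      2 * R S n + if Even n then S.indicator (1 : ℕ → ℤ) (n / 2) else 0 := by
  classical
  set c := S.indicator (1 : ℕ → ℤ) with hc
  have hR : ∑ x ∈ antidiagonal n, (if x.1 < x.2 then c x.1 * c x.2 else 0) = (R S n : ℤ) := by
    have hset : {p : ℕ × ℕ | p.1 ∈ S ∧ p.2 ∈ S ∧ p.1 < p.2 ∧ p.1 + p.2 = n} =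
        ((antidiagonal n).filter fun p => p.1 ∈ S ∧ p.2 ∈ S ∧ p.1 < p.2 : Finset (ℕ × ℕ)) := by
      ext p
      simp only [Set.mem_ofPred_eq, coe_filter, HasAntidiagonal.mem_antidiagonal]
      tauto
    rw [R, hset, Set.ncard_coe_finset, card_filter]
    push_cast
    refine sum_congr rfl fun x _ => ?_
    simp only [hc, Set.indicator_apply, Pi.one_apply]
    split_ifs <;> simp_all
  have hswap : ∑ x ∈ antidiagonal n, (if x.2 < x.1 then c x.1 * c x.2 else 0) = (R S n : ℤ) := by
    rw [← hR, ← Finset.Nat.sum_antidiagonal_swap]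
    exact sum_congr rfl fun x _ => by simp [mul_comm]
  have hdiag : ∑ x ∈ antidiagonal n, (if x.1 = x.2 then c x.1 * c x.2 else 0) =
      if Even n then c (n / 2) else 0 := by
    have hsq : ∀ k, c k * c k = c k := fun k => by
      simp only [hc, Set.indicator_apply, Pi.one_apply]
      split_ifs <;> simp
    split_ifs with h
    · obtain ⟨k, rfl⟩ := h
      rw [sum_eq_single (k, k)]
      · rw [if_pos rfl, hsq]
        congr 1
        omega
      · rintro ⟨a, b⟩ hab hne
        rw [HasAntidiagonal.mem_antidiagonal] at hab
        refine if_neg fun h => hne ?_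
        simp only at hab h
        ext <;> simp only <;> omega
      · simp
    · refine sum_eq_zero fun x hx => if_neg fun h' => h ⟨x.1, ?_⟩
      rw [HasAntidiagonal.mem_antidiagonal] at hx
      omega
  rw [two_mul]
  nth_rewrite 1 [← hR]
  rw [← hswap, ← hdiag, ← sum_add_distrib, ← sum_add_distrib]
  refine sum_congr rfl fun x _ => ?_
  rcases lt_trichotomy x.1 x.2 with h | h | h
  · simp [h, h.ne, h.not_gt]
  · simp [h]
  · simp [h, h.ne', h.not_gt]

/-- The difference of the indicator functions of `C` and `D`. -/
noncomputable def indicatorDiff (C D : Set ℕ) (n : ℕ) : ℤ :=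
  C.indicator (1 : ℕ → ℤ) n - D.indicator (1 : ℕ → ℤ) n

open Finset in
theorem sum_antidiagonal_indicatorDiff {C D : Set ℕ} {n : ℕ} (hR : R C n = R D n) :
    ∑ x ∈ antidiagonal n, indicatorDiff C D x.1 *
        (C.indicator (1 : ℕ → ℤ) x.2 + D.indicator (1 : ℕ → ℤ) x.2) =
      if Even n then indicatorDiff C D (n / 2) else 0 := by
  have hC := sum_antidiagonal_indicator_mul C n
  have hD := sum_antidiagonal_indicator_mul D n
  have hmix : ∑ x ∈ antidiagonal n, C.indicator (1 : ℕ → ℤ) x.1 * D.indicator (1 : ℕ → ℤ) x.2 =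
      ∑ x ∈ antidiagonal n, D.indicator (1 : ℕ → ℤ) x.1 * C.indicator (1 : ℕ → ℤ) x.2 := by
    rw [← Finset.Nat.sum_antidiagonal_swap]
    exact sum_congr rfl fun x _ => by simp [mul_comm]
  simp only [indicatorDiff, sub_mul, mul_add, sum_sub_distrib, sum_add_distrib]
  rw [hC, hD, hmix, hR]
  split_ifs <;> ring

theorem indicatorDiff_add_indicator_eq {C D : Set ℕ} {m r n : ℕ}
    (hCD : C ∪ D = Set.Icc 0 m \ {r}) (hdisj : C ∩ D = ∅) (hn : n ≤ m) :
    C.indicator (1 : ℕ → ℤ) n + D.indicator (1 : ℕ → ℤ) n = 1 - if n = r then 1 else 0 := by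
  have h1 : n ∈ C ∪ D ↔ n ∈ Set.Icc 0 m \ {r} := by rw [hCD]
  have h2 : n ∉ C ∩ D := by simp [hdisj]
  classical
  simp only [Set.mem_union, Set.mem_sdiff, Set.mem_Icc, Set.mem_singleton_iff, Set.mem_inter_iff,
    Set.indicator_apply, Pi.one_apply] at *
  split_ifs <;> simp_all

open Finset in
theorem indicatorDiff_sum_eq {C D : Set ℕ} {m r n : ℕ}
    (hCD : C ∪ D = Set.Icc 0 m \ {r}) (hdisj : C ∩ D = ∅) (hR : R C n = R D n) (hn : n ≤ m) :
    ∑ i ∈ range (n + 1), indicatorDiff C D i -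
        (if r ≤ n then indicatorDiff C D (n - r) else 0) =
      if Even n then indicatorDiff C D (n / 2) else 0 := by
  rw [← sum_antidiagonal_indicatorDiff hR]
  have h : ∀ x ∈ antidiagonal n, indicatorDiff C D x.1 *
        (C.indicator (1 : ℕ → ℤ) x.2 + D.indicator (1 : ℕ → ℤ) x.2) =
      indicatorDiff C D x.1 - if x.2 = r then indicatorDiff C D x.1 else 0 := by
    intro x hx
    rw [HasAntidiagonal.mem_antidiagonal] at hx
    rw [indicatorDiff_add_indicator_eq hCD hdisj (by omega)]
    split_ifs <;> ring
  rw [sum_congr rfl h, sum_sub_distrib,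
    Finset.Nat.sum_antidiagonal_eq_sum_range_succ_mk (fun x => indicatorDiff C D x.1)]
  congr 1
  split_ifs with hrn
  · rw [sum_eq_single (n - r, r)]
    · simp
    · rintro ⟨a, b⟩ hab hne
      rw [HasAntidiagonal.mem_antidiagonal] at hab
      refine if_neg fun h => hne ?_
      simp only at hab h
      ext <;> simp only <;> omega
    · intro h
      exact absurd (HasAntidiagonal.mem_antidiagonal.2 (by simp only; omega)) h
  · refine (sum_eq_zero fun x hx => if_neg fun h' => hrn ?_).symm
    rw [HasAntidiagonal.mem_antidiagonal] at hx
    omega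

theorem indicatorDiff_succ {C D : Set ℕ} {m r n : ℕ}
    (hCD : C ∪ D = Set.Icc 0 m \ {r}) (hdisj : C ∩ D = ∅) (hR : ∀ n : ℕ, R C n = R D n)
    (hn : n + 1 ≤ m) :
    indicatorDiff C D (n + 1) = (if r ≤ n + 1 then indicatorDiff C D (n + 1 - r) else 0) -
      (if r ≤ n then indicatorDiff C D (n - r) else 0) +
      (-1) ^ (n + 1) * indicatorDiff C D ((n + 1) / 2) := by
  have h1 := indicatorDiff_sum_eq hCD hdisj (hR (n + 1)) hn
  have h0 := indicatorDiff_sum_eq hCD hdisj (hR n) (by omega)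
  rw [Finset.sum_range_succ] at h1
  rcases Nat.even_or_odd n with he | ho
  · rw [if_neg (Nat.not_even_iff_odd.2 he.add_one)] at h1
    rw [if_pos he] at h0
    rw [he.add_one.neg_one_pow, show (n + 1) / 2 = n / 2 by obtain ⟨k, rfl⟩ := he; omega]
    linarith
  · rw [if_pos ho.add_one] at h1
    rw [if_neg (Nat.not_even_iff_odd.2 ho)] at h0
    rw [ho.add_one.neg_one_pow]
    linarith

/-- The Thue–Morse sequence with values `1` and `-1`. -/
def thueMorse (n : ℕ) : ℤ := (-1) ^ (Nat.digits 2 n).count 1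

theorem thueMorse_zero : thueMorse 0 = 1 := by simp [thueMorse]

theorem thueMorse_two_mul (n : ℕ) : thueMorse (2 * n) = thueMorse n := by
  rcases Nat.eq_zero_or_pos n with rfl | h
  · rfl
  · rw [thueMorse, Nat.digits_def' (by norm_num) (by omega)]
    simp [thueMorse]

theorem thueMorse_two_mul_add_one (n : ℕ) : thueMorse (2 * n + 1) = -thueMorse n := by
  rw [thueMorse, Nat.digits_def' (by norm_num) (by omega),
    show (2 * n + 1) % 2 = 1 by omega, show (2 * n + 1) / 2 = n by omega,
    List.count_cons_self, pow_succ, thueMorse]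
  ring

theorem thueMorse_eq_one_or (n : ℕ) : thueMorse n = 1 ∨ thueMorse n = -1 :=
  neg_one_pow_eq_or ℤ _

theorem thueMorse_eq_neg_one_pow_mul (n : ℕ) : thueMorse n = (-1) ^ n * thueMorse (n / 2) := by
  rcases Nat.even_or_odd' n with ⟨k, rfl | rfl⟩
  · rw [thueMorse_two_mul, (even_two_mul k).neg_one_pow, show 2 * k / 2 = k by omega, one_mul]
  · rw [thueMorse_two_mul_add_one, (odd_two_mul_add_one k).neg_one_pow,
      show (2 * k + 1) / 2 = k by omega, neg_one_mul]

theorem thueMorse_two_pow_add {k a : ℕ} (ha : a < 2 ^ k) :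
    thueMorse (2 ^ k + a) = -thueMorse a := by
  induction k generalizing a with
  | zero =>
    obtain rfl : a = 0 := by simpa using ha
    simpa using thueMorse_two_mul_add_one 0
  | succ k ih =>
    rw [pow_succ] at ha ⊢
    rcases Nat.even_or_odd' a with ⟨b, rfl | rfl⟩
    · rw [show 2 ^ k * 2 + 2 * b = 2 * (2 ^ k + b) by ring, thueMorse_two_mul, thueMorse_two_mul,
        ih (by omega)]
    · rw [show 2 ^ k * 2 + (2 * b + 1) = 2 * (2 ^ k + b) + 1 by ring, thueMorse_two_mul_add_one,
        thueMorse_two_mul_add_one, ih (by omega)]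

theorem mem_A_iff {n : ℕ} : n ∈ A ↔ thueMorse n = 1 :=
  (neg_one_pow_eq_one_iff_even (by norm_num)).symm

theorem mem_B_iff {n : ℕ} : n ∈ B ↔ thueMorse n = -1 := by
  have : n ∈ B ↔ ¬ n ∈ A := by simp [B]
  rw [this, mem_A_iff]
  rcases thueMorse_eq_one_or n with h | h <;> simp [h]

theorem exists_eq_two_pow_add {n : ℕ} (hn : n ≠ 0) : ∃ k a, a < 2 ^ k ∧ n = 2 ^ k + a := by
  refine ⟨Nat.log 2 n, n - 2 ^ Nat.log 2 n, ?_, ?_⟩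
  · have := Nat.lt_pow_succ_log_self one_lt_two n
    have := Nat.pow_log_le_self 2 hn
    rw [pow_succ] at *
    omega
  · have := Nat.pow_log_le_self 2 hn
    omega

theorem eq_two_pow_of_thueMorse_add_eq_neg {q : ℕ} (hq : q ≠ 0)
    (h : ∀ i < q, thueMorse (q + i) = -thueMorse i) : ∃ k, q = 2 ^ k := by
  obtain ⟨k, a, ha, rfl⟩ := exists_eq_two_pow_add hq
  rcases Nat.eq_zero_or_pos a with rfl | hpos
  · exact ⟨k, rfl⟩
  have h0 := h 0 (by omega)
  have h1 := h (2 ^ k) (by omega)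
  rw [add_zero, thueMorse_two_pow_add ha, thueMorse_zero] at h0
  have hk : thueMorse (2 ^ k) = -1 := by
    simpa [thueMorse_zero] using thueMorse_two_pow_add (k := k) (a := 0) (by positivity)
  rw [show 2 ^ k + a + 2 ^ k = 2 ^ (k + 1) + a by ring,
    thueMorse_two_pow_add (by rw [pow_succ]; omega), hk] at h1
  omega

theorem not_forall_thueMorse_add_eq {s : ℕ} (hs : 4 ≤ s) :
    ¬ ∀ i, i + 2 ≤ s → thueMorse (s + i) = thueMorse i := by
  intro h
  obtain ⟨k, a, ha, rfl⟩ := exists_eq_two_pow_add (n := s) (by omega)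
  have h0 := h 0 (by omega)
  rw [add_zero, thueMorse_two_pow_add ha, thueMorse_zero] at h0
  have t1 : thueMorse 1 = -1 := by simpa [thueMorse_zero] using thueMorse_two_mul_add_one 0
  have t2 : thueMorse 2 = -1 := by rw [← t1]; exact thueMorse_two_mul 1
  rcases Nat.lt_or_ge a 2 with ha2 | ha2
  · interval_cases a
    · rw [thueMorse_zero] at h0
      omega
    · have hk : 1 + 1 < 2 ^ k := by omega
      have h1 := h 1 (by omega)
      rw [add_assoc, thueMorse_two_pow_add hk, t1, t2] at h1
      omega
  · have h1 := h (2 ^ k) (by omega)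
    have hk : thueMorse (2 ^ k) = -1 := by
      simpa [thueMorse_zero] using thueMorse_two_pow_add (k := k) (a := 0) (by positivity)
    rw [show 2 ^ k + a + 2 ^ k = 2 ^ (k + 1) + a by ring,
      thueMorse_two_pow_add (by rw [pow_succ]; omega), hk] at h1
    omega

theorem eq_two_pow_of_thueMorse_add_eq {r : ℕ} (hr : 6 ≤ r) (htr : thueMorse r = -1)
    (h : ∀ j, j + 1 < r → thueMorse (j + 1) = -thueMorse j →
      thueMorse (r + 1 + j) = thueMorse j) : ∃ k, r = 2 ^ k := by
  have heven : ∀ i, 2 * i + 1 < r → thueMorse (r + 1 + 2 * i) = thueMorse i := fun i hi => by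
    rw [h (2 * i) hi (by rw [thueMorse_two_mul_add_one, thueMorse_two_mul]), thueMorse_two_mul]
  rcases Nat.even_or_odd' r with ⟨q, rfl | rfl⟩
  · obtain ⟨k, hk⟩ := eq_two_pow_of_thueMorse_add_eq_neg (q := q) (by omega) fun i hi => by
      have := heven i (by omega)
      rw [show 2 * q + 1 + 2 * i = 2 * (q + i) + 1 by ring, thueMorse_two_mul_add_one] at this
      omega
    exact ⟨k + 1, by rw [hk, pow_succ, mul_comm]⟩
  · refine absurd (fun i hi => ?_) (not_forall_thueMorse_add_eq (s := q + 1) (by omega))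
    have := heven i (by omega)
    rwa [show 2 * q + 1 + 1 + 2 * i = 2 * (q + 1 + i) by ring, thueMorse_two_mul] at this

theorem stmt_17 (m r : ℕ) (hr6 : 6 ≤ r) (hrm : 2 * r ≤ m) (C D : Set ℕ)
    (hCD : C ∪ D = Set.Icc 0 m \ {r}) (hdisj : C ∩ D = ∅) (h0C : 0 ∈ C)
    (hR : ∀ n : ℕ, R C n = R D n) :
    ∃ l : ℕ, 2 ≤ l ∧ r = 2 ^ (l - 1) ∧
      C ∩ Set.Icc 0 (2 * r) =
        Aset (l - 1) ∪ shift (2 ^ (l - 1) + 1) (Bset (l - 1)) ∧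
      D ∩ Set.Icc 0 (2 * r) =
        Bset (l - 1) ∪ shift (2 ^ (l - 1) + 1) (Aset (l - 1)) := by
  classical
  have hinter : ∀ n, ¬ (n ∈ C ∧ n ∈ D) := fun n hn => by
    have : n ∈ C ∩ D := hn
    simp [hdisj] at this
  have hunion : ∀ n, n ∈ C ∨ n ∈ D ↔ n ≤ m ∧ n ≠ r := fun n => by
    rw [← Set.mem_union, hCD]
    simp
  have hC : ∀ n, n ∈ C ↔ indicatorDiff C D n = 1 := fun n => by
    have := hinter n
    simp only [indicatorDiff, Set.indicator_apply, Pi.one_apply]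
    split_ifs <;> simp_all
  have hD : ∀ n, n ∈ D ↔ indicatorDiff C D n = -1 := fun n => by
    have := hinter n
    simp only [indicatorDiff, Set.indicator_apply, Pi.one_apply]
    split_ifs <;> simp_all
  have hpr : indicatorDiff C D r = 0 := by
    have : r ∉ C ∧ r ∉ D := by
      have := hunion r
      tauto
    simp [indicatorDiff, this.1, this.2]
  have hrec := fun n => indicatorDiff_succ (n := n) hCD hdisj hR
  set p := indicatorDiff C D
  have hp_lt : ∀ n < r, p n = thueMorse n := by
    intro n
    induction n using Nat.strong_induction_on with
    | _ n ih =>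
      intro hn
      rcases n with _ | n
      · rw [thueMorse_zero, ← hC]
        exact h0C
      · rw [hrec n (by omega), if_neg (by omega), if_neg (by omega),
          ih ((n + 1) / 2) (by omega) (by omega), thueMorse_eq_neg_one_pow_mul (n + 1)]
        ring
  have htr : thueMorse r = -1 := by
    have h := hrec (r - 1) (by omega)
    rw [Nat.sub_add_cancel (by omega), hpr, if_pos le_rfl, if_neg (by omega), Nat.sub_self,
      hp_lt 0 (by omega), thueMorse_zero, hp_lt (r / 2) (by omega),
      ← thueMorse_eq_neg_one_pow_mul] at h
    omega
  have hp_gt : ∀ j, j + 1 < r →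
      p (r + 1 + j) = thueMorse (j + 1) - thueMorse j + thueMorse (r + 1 + j) := by
    intro j hj
    have h := hrec (r + j) (by omega)
    rw [show r + j + 1 = r + 1 + j by ring, if_pos (by omega), if_pos (by omega),
      show r + 1 + j - r = j + 1 by omega, show r + j - r = j by omega,
      hp_lt (j + 1) hj, hp_lt j (by omega), hp_lt ((r + 1 + j) / 2) (by omega),
      ← thueMorse_eq_neg_one_pow_mul] at h
    exact h
  have hp_one : ∀ n ≤ m, n ≠ r → p n = 1 ∨ p n = -1 := fun n hn hnr => by
    rw [← hC, ← hD, hunion]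
    exact ⟨hn, hnr⟩
  obtain ⟨k, hk⟩ := eq_two_pow_of_thueMorse_add_eq hr6 htr fun j hj hne => by
    have h1 := hp_gt j hj
    have h2 := hp_one (r + 1 + j) (by omega) (by omega)
    rcases thueMorse_eq_one_or j with h3 | h3 <;>
      rcases thueMorse_eq_one_or (r + 1 + j) with h4 | h4 <;> omega
  have hp_shift : ∀ j < r, p (r + 1 + j) = -thueMorse j := by
    intro j hj
    rcases Nat.lt_or_ge (j + 1) r with hj1 | hj1
    · have := thueMorse_two_pow_add (k := k) (a := j + 1) (by omega)
      rw [hp_gt j hj1, show r + 1 + j = 2 ^ k + (j + 1) by omega, this]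
      ring
    · have h := hrec (r + j) (by omega)
      rw [show r + j + 1 = r + 1 + j by ring, if_pos (by omega), if_pos (by omega),
        show r + 1 + j - r = r by omega, show r + j - r = j by omega,
        show (r + 1 + j) / 2 = r by omega, hpr, hp_lt j hj] at h
      rw [h]
      ring
  refine ⟨k + 1, ?_, by simpa using hk, ?_, ?_⟩
  · have : k ≠ 0 := by
      rintro rfl
      omega
    omega
  all_goals
    rw [Nat.add_sub_cancel]
    ext x
    simp only [Aset, Bset, shift, Set.mem_inter_iff, Set.mem_union, Set.mem_image, Set.mem_Icc,
      mem_A_iff, mem_B_iff, hC, hD, ← hk]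
    rcases lt_trichotomy x r with hx | rfl | hx
    · rw [hp_lt x hx]
      constructor
      · rintro ⟨h, -⟩
        exact Or.inl ⟨h, by omega⟩
      · rintro (⟨h, -⟩ | ⟨s, -, hs⟩)
        · exact ⟨h, by omega⟩
        · omega
    · rw [hpr]
      constructor
      · rintro ⟨h, -⟩
        omega
      · rintro (⟨-, h⟩ | ⟨s, -, hs⟩) <;> omega
    · obtain ⟨j, rfl⟩ := Nat.exists_eq_add_of_le (Nat.succ_le_of_lt hx)
      rw [Nat.succ_eq_add_one]
      constructor
      · rintro ⟨h, -, hj⟩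
        rw [hp_shift j (by omega)] at h
        exact Or.inr ⟨j, ⟨by omega, by omega⟩, rfl⟩
      · rintro (⟨-, h⟩ | ⟨s, ⟨h, hsr⟩, hs⟩)
        · omega
        · obtain rfl : s = j := by omega
          rw [hp_shift s (by omega)]
          exact ⟨by omega, by omega⟩
end
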